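/- arXiv:2102.05852 — 9 statements merged into one kernel-verified Lean document; each statement's English description precedes it below -/
import Mathlib

section
/- For all integers b and k with 1 ≤ k ≤ b, the following identity holds: b! · Σ_{(t_1,…,t_k)} Π_{j=1}^{k} (2t_j − 3)!!/t_j! = k·(2b − k − 1)! / ((b − k)! · 2^{b−k}), where the sum ranges over all k-tuples of positive integers (t_1,…,t_k) with t_1 + ⋯ + t_k = b. (This is the number F(b,k) of ordered forests of k rooted binary leaf-labelled trees with b labelled leaves in total.) -/
/-- `doubleFactOdd m = (2m-1)!! = 1·3·5⋯(2m-1)`, with `(−1)!! = doubleFactOdd 0 = 1`. -/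
def doubleFactOdd : ℕ → ℕ
  | 0 => 1
  | (m+1) => (2*m+1) * doubleFactOdd m

open PowerSeries in
/-- The coefficients of a power of a power series, as a sum over tuples of exponents. -/
theorem coeff_pow_eq_sum_antidiagonalTuple {R : Type*} [CommSemiring R] (f : R⟦X⟧) (k n : ℕ) :
    coeff n (f ^ k) = ∑ t ∈ Finset.Nat.antidiagonalTuple k n, ∏ j, coeff (t j) f := by
  have h : f ^ k = ∏ _j : Fin k, f := by simp
  rw [h, coeff_prod]
  refine Finset.sum_nbij' (fun l => ⇑l) Finsupp.equivFunOnFinite.symm ?_ ?_ ?_ ?_ ?_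
  · intro l hl
    simpa [Finset.Nat.mem_antidiagonalTuple] using hl
  · intro t ht
    simpa [Finset.Nat.mem_antidiagonalTuple] using ht
  · intro l _
    ext
    simp
  · intro t _
    simp
  · intro l _
    rfl

/-- The exponential generating function of rooted binary leaf-labelled trees. -/
noncomputable def binaryTreeSeries : PowerSeries ℝ :=
  PowerSeries.mk fun t => if 0 < t then (doubleFactOdd (t - 1) : ℝ) / t.factorial else 0

open PowerSeries in
theorem constantCoeff_binaryTreeSeries : constantCoeff binaryTreeSeries = 0 := by
  rw [← coeff_zero_eq_constantCoeff_apply]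
  simp [binaryTreeSeries]

open PowerSeries in
theorem derivative_binaryTreeSeries :
    (1 - 2 * X) * d⁄dX ℝ binaryTreeSeries = 1 - binaryTreeSeries := by
  have h2 : (2 : ℝ⟦X⟧) = C 2 := (map_ofNat C 2).symm
  ext n
  rw [h2, sub_mul, one_mul, mul_assoc, map_sub, coeff_C_mul, map_sub, coeff_derivative]
  rcases n with _ | n
  · simp [binaryTreeSeries, doubleFactOdd]
  · rw [coeff_succ_X_mul, coeff_derivative]
    simp only [binaryTreeSeries, coeff_mk, Nat.succ_pos, if_true, Nat.add_sub_cancel, coeff_one,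
      doubleFactOdd, Nat.factorial_succ, Nat.succ_ne_zero, if_false]
    have := Nat.factorial_ne_zero n
    push_cast
    field_simp
    ring

open PowerSeries in
/-- A rooted binary tree is a leaf or an unordered pair of rooted binary trees. -/
theorem binaryTreeSeries_sq :
    binaryTreeSeries ^ 2 = 2 * binaryTreeSeries - 2 * X := by
  set T := binaryTreeSeries with hT
  set V := T ^ 2 - 2 * T + 2 * X with hV
  have h2 : (2 : ℝ⟦X⟧) = C 2 := (map_ofNat C 2).symm
  have hD : d⁄dX ℝ V = 2 * T * d⁄dX ℝ T - 2 * d⁄dX ℝ T + 2 := by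
    rw [hV, h2]
    simp only [map_add, map_sub, Derivation.leibniz, derivative_C, derivative_X, pow_two,
      smul_eq_mul]
    rw [← h2]
    ring
  have hode : d⁄dX ℝ V - C 2 * (X * d⁄dX ℝ V) = -(C 2 * V) := by
    rw [hD, ← h2, hV]
    linear_combination (2 * T - 2) * derivative_binaryTreeSeries
  have hV0 : V = 0 := by
    ext n
    induction n with
    | zero => simp [hV, hT, constantCoeff_binaryTreeSeries]
    | succ n ih =>
      have h := congrArg (coeff n) hode
      rw [map_zero] at ih
      have hX : coeff n (X * d⁄dX ℝ V) = n * coeff n V := by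
        rcases n with _ | n
        · simp
        · rw [coeff_succ_X_mul, coeff_derivative]
          push_cast
          ring
      rw [map_sub, map_neg, coeff_C_mul, coeff_C_mul, hX, ih, coeff_derivative] at h
      have hn : (n : ℝ) + 1 ≠ 0 := by positivity
      simpa [hn] using h
  linear_combination hV0

theorem doubleFactOdd_mul (m : ℕ) :
    doubleFactOdd m * (m.factorial * 2 ^ m) = (2 * m).factorial := by
  induction m with
  | zero => simp [doubleFactOdd]
  | succ m ih =>
    rw [doubleFactOdd, Nat.factorial_succ, show 2 * (m + 1) = 2 * m + 1 + 1 by ring,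
      Nat.factorial_succ, Nat.factorial_succ, ← ih]
    ring

open PowerSeries in
theorem coeff_binaryTreeSeries_pow (k m : ℕ) :
    coeff (k + 1 + m) (binaryTreeSeries ^ (k + 1)) =
      ((k + 1) * (k + 2 * m).factorial : ℝ) / (m.factorial * 2 ^ m * (k + 1 + m).factorial) := by
  have h2 : (2 : ℝ⟦X⟧) = C 2 := (map_ofNat C 2).symm
  have h0 (m : ℕ) : coeff (m + 1) binaryTreeSeries =
      ((2 * m).factorial : ℝ) / (m.factorial * 2 ^ m * (m + 1).factorial) := by
    rw [← doubleFactOdd_mul]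
    simp only [binaryTreeSeries, coeff_mk, Nat.succ_pos, if_true, Nat.add_sub_cancel]
    have := Nat.factorial_ne_zero m
    have := Nat.factorial_ne_zero (m + 1)
    push_cast
    field_simp
  induction k using Nat.twoStepInduction generalizing m with
  | zero =>
    rw [zero_add, pow_one, add_comm 1 m, h0]
    simp
  | one =>
    rw [show 1 + 1 + m = m + 1 + 1 by ring, one_add_one_eq_two, binaryTreeSeries_sq, h2, map_sub,
      coeff_C_mul, coeff_C_mul, h0, coeff_X, if_neg (by omega),
      show 2 * (m + 1) = 1 + 2 * m + 1 by ring]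
    simp only [Nat.factorial_succ]
    have := Nat.factorial_ne_zero m
    push_cast
    field_simp
    ring
  | more k ih ih' =>
    have hrec : binaryTreeSeries ^ (k + 2 + 1) =
        C 2 * binaryTreeSeries ^ (k + 1 + 1) - C 2 * (X * binaryTreeSeries ^ (k + 1)) := by
      rw [← h2]
      linear_combination binaryTreeSeries ^ (k + 1) * binaryTreeSeries_sq
    have h₁ := ih' (m + 1)
    have h₂ := ih (m + 1)
    rw [show k + 1 + 1 + (m + 1) = k + m + 1 + 1 + 1 by ring,
      show k + 1 + 2 * (m + 1) = k + 2 * m + 1 + 1 + 1 by ring] at h₁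
    rw [show k + 1 + (m + 1) = k + m + 1 + 1 by ring,
      show k + 2 * (m + 1) = k + 2 * m + 1 + 1 by ring] at h₂
    rw [hrec, show k + 2 + 1 + m = k + m + 1 + 1 + 1 by ring,
      show k + 2 + 2 * m = k + 2 * m + 1 + 1 by ring, map_sub, coeff_C_mul, coeff_C_mul,
      coeff_succ_X_mul, h₁, h₂]
    simp only [Nat.factorial_succ]
    have := Nat.factorial_ne_zero m
    have := Nat.factorial_ne_zero (k + m)
    push_cast
    field_simp
    ring

/-- For `1 ≤ k ≤ b`,
`b! · Σ_{t_1+⋯+t_k=b, t_j ≥ 1} Π_j (2t_j−3)!!/t_j! = k·(2b−k−1)!/((b−k)!·2^{b−k})`. -/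
theorem forest_count (b k : ℕ) (hk : 1 ≤ k) (hkb : k ≤ b) :
    (b.factorial : ℝ) *
      ∑ t ∈ (Finset.Nat.antidiagonalTuple k b).filter (fun t => ∀ j, 0 < t j),
        ∏ j, (doubleFactOdd (t j - 1) : ℝ) / (t j).factorial
    = (k : ℝ) * (2*b - k - 1).factorial / ((b - k).factorial * 2^(b-k)) := by
  have hsum : ∑ t ∈ (Finset.Nat.antidiagonalTuple k b).filter (fun t => ∀ j, 0 < t j),
        ∏ j, (doubleFactOdd (t j - 1) : ℝ) / (t j).factorial =
      PowerSeries.coeff b (binaryTreeSeries ^ k) := by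
    rw [coeff_pow_eq_sum_antidiagonalTuple, Finset.sum_filter]
    refine Finset.sum_congr rfl fun t _ => ?_
    simp only [binaryTreeSeries, PowerSeries.coeff_mk]
    split_ifs with h
    · exact Finset.prod_congr rfl fun j _ => (if_pos (h j)).symm
    · push Not at h
      obtain ⟨j, hj⟩ := h
      exact (Finset.prod_eq_zero (Finset.mem_univ j) (if_neg hj.not_gt)).symm
  obtain ⟨k, rfl⟩ := Nat.exists_eq_add_of_le' hk
  obtain ⟨m, rfl⟩ := Nat.exists_eq_add_of_le hkb
  rw [hsum, coeff_binaryTreeSeries_pow, show 2 * (k + 1 + m) - (k + 1) - 1 = k + 2 * m by omega,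
    Nat.add_sub_cancel_left]
  have := Nat.factorial_ne_zero (k + 1 + m)
  push_cast
  field_simp
end

section
/- For every integer k ≥ 1 and every real x with |x| < 1/2: (1 − √(1 − 2x))^k = Σ_{b=k}^{∞} [k·(2b − k − 1)! / ((b − k)! · 2^{b−k} · b!)] · x^b, the series converging absolutely. -/
/-- The partial sums of `∑ catalan m / 4 ^ m` telescope. -/
lemma sum_range_catalan_div_four_pow (n : ℕ) :
    ∑ m ∈ Finset.range n, (catalan m : ℝ) * (1 / 4) ^ m =
      2 * (1 - (n.centralBinom : ℝ) / 4 ^ n) := by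
  induction n with
  | zero => simp
  | succ n ih =>
    have h₁ : ((n : ℝ) + 1) * ((n + 1).centralBinom : ℝ) =
        2 * (2 * n + 1) * n.centralBinom := by
      exact_mod_cast n.succ_mul_centralBinom_succ
    have h₂ : ((n : ℝ) + 1) * catalan n = n.centralBinom := by
      exact_mod_cast succ_mul_catalan_eq_centralBinom n
    have hn : (n : ℝ) + 1 ≠ 0 := by positivity
    have h₃ : ((n + 1).centralBinom : ℝ) = 2 * (2 * n + 1) * catalan n := by
      apply mul_left_cancel₀ hn
      rw [h₁, ← h₂]
      ring
    rw [Finset.sum_range_succ, ih, h₃, ← h₂, one_div, inv_pow, pow_succ]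
    field_simp
    ring

lemma sum_range_catalan_div_four_pow_le (n : ℕ) :
    ∑ m ∈ Finset.range n, (catalan m : ℝ) * (1 / 4) ^ m ≤ 2 := by
  rw [sum_range_catalan_div_four_pow]
  have : (0 : ℝ) ≤ (n.centralBinom : ℝ) / 4 ^ n := by positivity
  linarith

lemma summable_catalan_div_four_pow :
    Summable fun m : ℕ => (catalan m : ℝ) * (1 / 4) ^ m :=
  summable_of_sum_range_le (fun _ => by positivity) sum_range_catalan_div_four_pow_le

lemma norm_catalan_mul_pow_le {t : ℝ} (ht : |t| ≤ 1 / 4) (m : ℕ) :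
    ‖(catalan m : ℝ) * t ^ m‖ ≤ (catalan m : ℝ) * (1 / 4) ^ m := by
  rw [norm_mul, norm_pow, Real.norm_natCast, Real.norm_eq_abs]
  gcongr

lemma summable_norm_catalan_mul_pow {t : ℝ} (ht : |t| ≤ 1 / 4) :
    Summable fun m : ℕ => ‖(catalan m : ℝ) * t ^ m‖ :=
  .of_nonneg_of_le (fun _ => norm_nonneg _) (norm_catalan_mul_pow_le ht)
    summable_catalan_div_four_pow

lemma abs_tsum_catalan_mul_pow_le {t : ℝ} (ht : |t| ≤ 1 / 4) :
    |∑' m : ℕ, (catalan m : ℝ) * t ^ m| ≤ 2 :=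
  (tsum_of_norm_bounded summable_catalan_div_four_pow.hasSum (norm_catalan_mul_pow_le ht)).trans
    (Real.tsum_le_of_sum_range_le (fun _ => by positivity) sum_range_catalan_div_four_pow_le)

lemma tsum_catalan_mul_pow_eq {t : ℝ} (ht : |t| ≤ 1 / 4) :
    ∑' m : ℕ, (catalan m : ℝ) * t ^ m = 1 + t * (∑' m : ℕ, (catalan m : ℝ) * t ^ m) ^ 2 := by
  have hs := summable_norm_catalan_mul_pow ht
  rw [sq, tsum_mul_tsum_eq_tsum_sum_antidiagonal_of_summable_norm hs hs,
    hs.of_norm.tsum_eq_zero_add, ← tsum_mul_left]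
  congr 1
  · simp
  · refine tsum_congr fun n => ?_
    rw [catalan_succ', Nat.cast_sum, Finset.sum_mul, Finset.mul_sum]
    refine Finset.sum_congr rfl fun p hp => ?_
    rw [← Finset.HasAntidiagonal.mem_antidiagonal.mp hp]
    push_cast
    ring

lemma mul_tsum_catalan_eq_one_sub_sqrt {x : ℝ} (hx : |x| ≤ 1 / 2) :
    x * ∑' m : ℕ, (catalan m : ℝ) * (x / 2) ^ m = 1 - √(1 - 2 * x) := by
  have ht : |x / 2| ≤ 1 / 4 := by
    rw [abs_div, abs_two]
    linarith
  have hc := abs_tsum_catalan_mul_pow_le ht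
  have he := tsum_catalan_mul_pow_eq ht
  set c := ∑' m : ℕ, (catalan m : ℝ) * (x / 2) ^ m
  have hxc : x * c ≤ 1 := by
    calc x * c ≤ |x| * |c| := by rw [← abs_mul]; exact le_abs_self _
      _ ≤ 1 / 2 * 2 := by gcongr
      _ = 1 := by norm_num
  have hsq : 1 - 2 * x = (1 - x * c) ^ 2 := by linear_combination (2 * x) * he
  rw [hsq, Real.sqrt_sq (by linarith)]
  ring

lemma catalan_eq_factorial_div (m : ℕ) :
    (catalan m : ℝ) = (2 * m).factorial / (m.factorial * (m + 1).factorial) := by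
  have h₂ : ((m : ℝ) + 1) * catalan m = m.centralBinom := by
    exact_mod_cast succ_mul_catalan_eq_centralBinom m
  have h₁ : (m.centralBinom : ℝ) = (2 * m).factorial / (m.factorial * m.factorial) := by
    rw [Nat.centralBinom_eq_two_mul_choose, Nat.cast_choose ℝ (by omega : m ≤ 2 * m),
      show 2 * m - m = m by omega]
  have hm : (m : ℝ) + 1 ≠ 0 := by positivity
  apply mul_left_cancel₀ hm
  rw [h₂, h₁, Nat.factorial_succ]
  push_cast
  field_simp

/-- The coefficient of `x ^ (m + j + 1)` in `(1 - √(1 - 2 * x)) ^ (j + 1)`. -/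
noncomputable def binaryForestCoeff (j m : ℕ) : ℝ :=
  ((j : ℝ) + 1) * (2 * m + j).factorial / ((m.factorial : ℝ) * 2 ^ m * (m + j + 1).factorial)

lemma binaryForestCoeff_zero_right (j : ℕ) : binaryForestCoeff j 0 = 1 := by
  have := Nat.factorial_ne_zero j
  simp only [binaryForestCoeff, mul_zero, zero_add, Nat.factorial_zero, Nat.factorial_succ]
  push_cast
  field_simp

lemma binaryForestCoeff_one (m : ℕ) :
    binaryForestCoeff 1 m = 2 * binaryForestCoeff 0 (m + 1) := by
  simp only [binaryForestCoeff, show 2 * (m + 1) + 0 = 2 * m + 1 + 1 by ring,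
    show m + 1 + 0 + 1 = m + 1 + 1 by ring, Nat.factorial_succ, pow_succ]
  push_cast
  field_simp
  ring

lemma binaryForestCoeff_add_two (j m : ℕ) :
    binaryForestCoeff (j + 2) m =
      2 * binaryForestCoeff (j + 1) (m + 1) - 2 * binaryForestCoeff j (m + 1) := by
  simp only [binaryForestCoeff, show 2 * (m + 1) + (j + 1) = 2 * m + j + 2 + 1 by ring,
    show 2 * (m + 1) + j = 2 * m + j + 2 by ring, show 2 * m + (j + 2) = 2 * m + j + 2 by ring,
    show m + (j + 2) + 1 = m + j + 2 + 1 by ring, show m + 1 + (j + 1) + 1 = m + j + 2 + 1 by ring,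
    show m + 1 + j + 1 = m + j + 2 by ring, Nat.factorial_succ (2 * m + j + 2),
    Nat.factorial_succ (m + j + 2), Nat.factorial_succ m, pow_succ]
  push_cast
  field_simp
  ring

lemma hasSum_binaryForestCoeff_zero {x : ℝ} (hx : |x| ≤ 1 / 2) :
    HasSum (fun m : ℕ => binaryForestCoeff 0 m * x ^ (m + 1)) (1 - √(1 - 2 * x)) := by
  have ht : |x / 2| ≤ 1 / 4 := by
    rw [abs_div, abs_two]
    linarith
  rw [← mul_tsum_catalan_eq_one_sub_sqrt hx]
  refine HasSum.congr_fun
    ((summable_norm_catalan_mul_pow ht).of_norm.hasSum.mul_left x) fun m => ?_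
  rw [catalan_eq_factorial_div, binaryForestCoeff, div_pow]
  simp only [add_zero, Nat.cast_zero, zero_add, one_mul]
  field_simp
  exact pow_succ' x m

lemma hasSum_binaryForestCoeff {x : ℝ} (hx : |x| ≤ 1 / 2) (j : ℕ) :
    HasSum (fun m : ℕ => binaryForestCoeff j m * x ^ (m + j + 1))
      ((1 - √(1 - 2 * x)) ^ (j + 1)) := by
  have h0 := hasSum_binaryForestCoeff_zero hx
  have hsq : √(1 - 2 * x) ^ 2 = 1 - 2 * x :=
    Real.sq_sqrt (by linarith [(abs_le.mp hx).2])
  induction j using Nat.twoStepInduction with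
  | zero => simpa using h0
  | one =>
    have h := ((hasSum_nat_add_iff' 1).mpr h0).mul_left 2
    rw [Finset.sum_range_one, binaryForestCoeff_zero_right] at h
    have hval : (1 - √(1 - 2 * x)) ^ (1 + 1) = 2 * (1 - √(1 - 2 * x) - 1 * x ^ (0 + 1)) := by
      linear_combination hsq
    rw [hval]
    refine h.congr_fun fun m => ?_
    rw [binaryForestCoeff_one]
    ring
  | more j ih₀ ih₁ =>
    have h := (hasSum_nat_add_iff' 1).mpr ((ih₁.mul_left 2).sub (ih₀.mul_left (2 * x)))
    rw [Finset.sum_range_one, binaryForestCoeff_zero_right, binaryForestCoeff_zero_right] at h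
    have hval : (1 - √(1 - 2 * x)) ^ (j + 2 + 1) =
        2 * (1 - √(1 - 2 * x)) ^ (j + 1 + 1) - 2 * x * (1 - √(1 - 2 * x)) ^ (j + 1) -
          (2 * (1 * x ^ (0 + (j + 1) + 1)) - 2 * x * (1 * x ^ (0 + j + 1))) := by
      linear_combination (1 - √(1 - 2 * x)) ^ (j + 1) * hsq
    rw [hval]
    refine h.congr_fun fun m => ?_
    rw [binaryForestCoeff_add_two]
    ring

/-- For `k ≥ 1` and `|x| < 1/2`,
`(1 − √(1−2x))^k = Σ_{b=k}^∞ [k·(2b−k−1)!/((b−k)!·2^{b−k}·b!)]·x^b`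
(written with `b = m + k`), the series converging absolutely (in `ℝ`,
`HasSum` is equivalent to absolute convergence to the given sum). -/
theorem binary_forest_gf (k : ℕ) (hk : 1 ≤ k) (x : ℝ) (hx : |x| < 1/2) :
    HasSum
      (fun m : ℕ =>
        (k : ℝ) * (2*m + k - 1).factorial / ((m.factorial : ℝ) * 2^m * (m+k).factorial)
          * x^(m+k))
      ((1 - Real.sqrt (1 - 2*x))^k) := by
  obtain ⟨j, rfl⟩ : ∃ j, k = j + 1 := ⟨k - 1, by omega⟩
  refine (hasSum_binaryForestCoeff hx.le j).congr_fun fun m => ?_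
  rw [binaryForestCoeff, show 2 * m + (j + 1) - 1 = 2 * m + j by omega, Nat.cast_succ, add_assoc]
end

section
/- For all integers a ≥ 2 and b ≥ 1: Σ_{k=1}^{b} binom(k + 2a − 3, 2a − 3) · k·(2b − k − 1)! / ((b − k)! · 2^{b−k}) = b! · 2^b · binom(a + b − 2, b). (Equivalently, Σ_{k≤b} F(b,k)·binom(k+2a−3,2a−3) = b!·[x^b](1−2x)^{−(a−1)}, where F(b,k) = k(2b−k−1)!/((b−k)! 2^{b−k}) counts ordered forests of k rooted binary trees with b labelled leaves in total.) -/
/-- The number of ordered forests of `k` rooted binary trees with `b` labelled leaves in total. -/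
noncomputable def binaryForestCount (b k : ℕ) : ℝ :=
  if k = 0 then (if b = 0 then 1 else 0)
  else if b < k then 0
  else (k : ℝ) * (2 * b - k - 1).factorial / ((b - k).factorial * 2 ^ (b - k))

lemma binaryForestCount_zero_zero : binaryForestCount 0 0 = 1 := by
  simp [binaryForestCount]

lemma binaryForestCount_succ_zero (b : ℕ) : binaryForestCount (b + 1) 0 = 0 := by
  simp [binaryForestCount]

lemma binaryForestCount_of_lt {b k : ℕ} (h : b < k) : binaryForestCount b k = 0 := by
  simp [binaryForestCount, h, Nat.ne_zero_of_lt h]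

lemma binaryForestCount_add (k d : ℕ) :
    binaryForestCount (k + 1 + d) (k + 1) =
      ((k : ℝ) + 1) * (k + 2 * d).factorial / (d.factorial * 2 ^ d) := by
  have h₁ : 2 * (k + 1 + d) - (k + 1) - 1 = k + 2 * d := by omega
  have h₂ : k + 1 + d - (k + 1) = d := by omega
  rw [binaryForestCount, if_neg k.succ_ne_zero, if_neg (by omega), h₁, h₂]
  push_cast
  rfl

/-- The coefficient form of `u ^ 2 = 2 * u - 2 * x` for the generating function `u` of trees. -/
lemma binaryForestCount_succ_add_two (b k : ℕ) :
    binaryForestCount (b + 1) (k + 2) =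
      2 * binaryForestCount (b + 1) (k + 1) - 2 * (b + 1) * binaryForestCount b k := by
  obtain h | h := lt_or_ge b k
  · rw [binaryForestCount_of_lt h, binaryForestCount_of_lt (by omega : b + 1 < k + 1),
      binaryForestCount_of_lt (by omega : b + 1 < k + 2)]
    ring
  obtain ⟨d, rfl⟩ := Nat.exists_eq_add_of_le h
  have h₁ := binaryForestCount_add k d
  rw [show k + 1 + d = k + d + 1 by ring] at h₁
  rw [h₁]
  rcases d with _ | e
  · rw [binaryForestCount_of_lt (by omega : k + 0 + 1 < k + 2)]
    rcases k with _ | j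
    · simp [binaryForestCount_zero_zero]
    · have h₃ := binaryForestCount_add j 0
      rw [h₃]
      simp only [Nat.factorial_succ, mul_zero, add_zero, Nat.factorial_zero]
      push_cast
      ring
  · have h₂ := binaryForestCount_add (k + 1) e
    rw [show k + 1 + 1 + e = k + (e + 1) + 1 by ring] at h₂
    rw [h₂, show k + 2 * (e + 1) = k + 2 * e + 1 + 1 by ring,
      show k + 1 + 2 * e = k + 2 * e + 1 by ring]
    have he : (e.factorial : ℝ) ≠ 0 := by positivity
    rcases k with _ | j
    · rw [show 0 + (e + 1) = e + 1 by ring, binaryForestCount_succ_zero]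
      simp only [Nat.factorial_succ]
      push_cast
      field_simp
      ring
    · have h₃ := binaryForestCount_add j (e + 1)
      rw [h₃, show j + 2 * (e + 1) = j + 1 + 2 * e + 1 by ring]
      simp only [Nat.factorial_succ]
      push_cast
      field_simp
      ring

lemma sum_range_multichoose_mul (m N : ℕ) (g : ℕ → ℝ) :
    ∑ k ∈ Finset.range (N + 1), (m.multichoose k : ℝ) * g k =
      ∑ k ∈ Finset.range (N + 1), ((m + 1).multichoose k : ℝ) * (g k - g (k + 1)) +
        ((m + 1).multichoose N : ℝ) * g (N + 1) := by
  induction N with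
  | zero => simp
  | succ N ih =>
    rw [Finset.sum_range_succ, ih, Finset.sum_range_succ _ (N + 1), Nat.multichoose_succ_succ m N]
    push_cast
    ring

lemma sum_range_multichoose_mul_binaryForestCount_succ (m b : ℕ) :
    ∑ k ∈ Finset.range (b + 2), ((m + 2).multichoose k : ℝ) * binaryForestCount (b + 1) k =
      ∑ k ∈ Finset.range (b + 2), (m.multichoose k : ℝ) * binaryForestCount (b + 1) k +
        2 * (b + 1) *
          ∑ k ∈ Finset.range (b + 1), ((m + 2).multichoose k : ℝ) * binaryForestCount b k := by
  have h : ∑ k ∈ Finset.range (b + 1), ((m + 2).multichoose k : ℝ) * binaryForestCount b k =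
      ∑ k ∈ Finset.range (b + 2), ((m + 2).multichoose k : ℝ) * binaryForestCount b k := by
    rw [Finset.sum_range_succ _ (b + 1), binaryForestCount_of_lt b.lt_succ_self, mul_zero, add_zero]
  rw [h, sum_range_multichoose_mul m, sum_range_multichoose_mul (m + 1),
    binaryForestCount_of_lt (by omega : b + 1 < b + 1 + 1),
    binaryForestCount_of_lt (by omega : b + 1 < b + 1 + 1 + 1), sub_zero, mul_zero, add_zero,
    mul_zero, add_zero, Finset.mul_sum, ← Finset.sum_add_distrib]
  refine Finset.sum_congr rfl fun k _ => ?_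
  rw [show k + 1 + 1 = k + 2 by ring, binaryForestCount_succ_add_two]
  ring

lemma sum_range_multichoose_mul_binaryForestCount (c b : ℕ) :
    ∑ k ∈ Finset.range (b + 1), ((2 * c).multichoose k : ℝ) * binaryForestCount b k =
      b.factorial * 2 ^ b * c.multichoose b := by
  induction b generalizing c with
  | zero => simp [binaryForestCount_zero_zero]
  | succ b ihb =>
    induction c with
    | zero =>
      rw [Finset.sum_range_succ']
      simp [binaryForestCount_succ_zero]
    | succ c ihc =>
      have hb := ihb (c + 1)
      rw [mul_add_one] at hb ⊢
      rw [sum_range_multichoose_mul_binaryForestCount_succ, ihc, hb, Nat.multichoose_succ_succ,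
        Nat.factorial_succ]
      push_cast
      ring

/-- For `a ≥ 2`, `b ≥ 1`:
`Σ_{k=1}^{b} binom(k+2a−3, 2a−3)·k·(2b−k−1)!/((b−k)!·2^{b−k}) = b!·2^b·binom(a+b−2, b)`. -/
theorem expanded_forest_count (a b : ℕ) (ha : 2 ≤ a) (hb : 1 ≤ b) :
    ∑ k ∈ Finset.Icc 1 b,
      (Nat.choose (k + 2*a - 3) (2*a - 3) : ℝ) *
        ((k : ℝ) * (2*b - k - 1).factorial) / ((b - k).factorial * 2^(b-k))
    = (b.factorial : ℝ) * 2^b * Nat.choose (a + b - 2) b := by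
  obtain ⟨c, rfl⟩ := Nat.exists_eq_add_of_le ha
  obtain ⟨n, rfl⟩ := Nat.exists_eq_add_of_le' hb
  have h := sum_range_multichoose_mul_binaryForestCount (c + 1) (n + 1)
  rw [Nat.multichoose_eq, show c + 1 + (n + 1) - 1 = 2 + c + (n + 1) - 2 by omega] at h
  rw [← h, Finset.sum_range_succ', binaryForestCount_succ_zero, mul_zero, add_zero,
    ← Finset.Ico_add_one_right_eq_Icc, Finset.sum_Ico_eq_sum_range, Nat.add_sub_cancel]
  refine Finset.sum_congr rfl fun k hk => ?_
  have hkn : k < n + 1 := Finset.mem_range.mp hk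
  rw [binaryForestCount, if_neg k.succ_ne_zero, if_neg (by omega), Nat.multichoose_eq, add_comm 1 k,
    show 2 * (c + 1) + (k + 1) - 1 = k + 1 + 2 * (2 + c) - 3 by omega,
    ← Nat.choose_symm_of_eq_add
      (by omega : k + 1 + 2 * (2 + c) - 3 = (2 * (2 + c) - 3) + (k + 1)), mul_div_assoc]
end

section
/- For all integers a ≥ 2 and ν ≥ 0: Σ_{b=0}^{ν} binom(ν, b) · b! · 2^b · binom(a + b − 2, b) · (2(ν − b) − 1)!! = (2(ν + a) − 3)!! / (2a − 3)!!. (With n := a + ν + 1, the right-hand side equals (2n − 5)!!/(2a − 3)!!, which is the number of unrooted binary trees with leaf-set [n] in which a fixed leaf-set S of size a induces a given rooted binary tree.) -/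
/-- The Vandermonde identity for products of arithmetic progressions with common step `d`. -/
theorem sum_antidiagonal_choose_mul_prod_add_mul_prod_add {R : Type*} [CommRing R]
    (x y d : R) (n : ℕ) :
    ∑ p ∈ Finset.HasAntidiagonal.antidiagonal n, (n.choose p.1 : R) *
        ((∏ i ∈ Finset.range p.1, (x + d * i)) * ∏ i ∈ Finset.range p.2, (y + d * i)) =
      ∏ i ∈ Finset.range n, (x + y + d * i) := by
  induction n with
  | zero => simp
  | succ n ih =>
    rw [Finset.sum_antidiagonal_choose_succ_mul (fun k l ↦
        (∏ i ∈ Finset.range k, (x + d * i)) * ∏ i ∈ Finset.range l, (y + d * i)),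
      Finset.prod_range_succ, ← ih, Finset.sum_mul, ← Finset.sum_add_distrib]
    refine Finset.sum_congr rfl fun p hp ↦ ?_
    obtain rfl := Finset.HasAntidiagonal.mem_antidiagonal.mp hp
    rw [Nat.choose_symm_add, Finset.prod_range_succ, Finset.prod_range_succ]
    push_cast
    ring

theorem doubleFactOdd_pos (m : ℕ) : 0 < doubleFactOdd m := by
  induction m with
  | zero => simp [doubleFactOdd]
  | succ m ih => rw [doubleFactOdd]; positivity

theorem doubleFactOdd_add (c n : ℕ) :
    (doubleFactOdd (n + c) : ℝ) =
      (∏ i ∈ Finset.range n, (2 * (c : ℝ) + 1 + 2 * i)) * doubleFactOdd c := by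
  induction n with
  | zero => simp
  | succ n ih =>
    rw [Nat.add_right_comm, doubleFactOdd, Nat.cast_mul, ih, Finset.prod_range_succ]
    push_cast
    ring

theorem doubleFactOdd_eq_prod (n : ℕ) :
    (doubleFactOdd n : ℝ) = ∏ i ∈ Finset.range n, (1 + 2 * (i : ℝ)) := by
  simpa [doubleFactOdd] using doubleFactOdd_add 0 n

theorem factorial_mul_two_pow_mul_choose (k b : ℕ) :
    (b.factorial : ℝ) * 2 ^ b * (k + b).choose b =
      ∏ i ∈ Finset.range b, (2 * ((k : ℝ) + 1) + 2 * i) := by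
  have h : (b.factorial : ℝ) * (k + b).choose b = ∏ i ∈ Finset.range b, ((k : ℝ) + 1 + i) := by
    exact_mod_cast (Nat.ascFactorial_eq_factorial_mul_choose k b).symm.trans
      (Nat.ascFactorial_eq_prod_range _ b)
  simp_rw [← mul_add, Finset.prod_mul_distrib, ← h, Finset.prod_const, Finset.card_range]
  ring

/-- For `a ≥ 2` and `ν ≥ 0`:
`Σ_{b=0}^{ν} binom(ν,b)·b!·2^b·binom(a+b−2,b)·(2(ν−b)−1)!! = (2(ν+a)−3)!!/(2a−3)!!`. -/
theorem unrooted_tree_count (a ν : ℕ) (ha : 2 ≤ a) :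
    ∑ b ∈ Finset.range (ν + 1),
      (Nat.choose ν b : ℝ) * b.factorial * 2^b * Nat.choose (a + b - 2) b *
        doubleFactOdd (ν - b)
    = (doubleFactOdd (ν + a - 1) : ℝ) / doubleFactOdd (a - 1) := by
  obtain ⟨k, rfl⟩ := Nat.exists_eq_add_of_le' ha
  have hpos : (doubleFactOdd (k + 1) : ℝ) ≠ 0 := by
    exact_mod_cast (doubleFactOdd_pos (k + 1)).ne'
  rw [show ν + (k + 2) - 1 = ν + (k + 1) by omega, show k + 2 - 1 = k + 1 by omega,
    doubleFactOdd_add, mul_div_cancel_right₀ _ hpos, Nat.cast_add_one,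
    ← sum_antidiagonal_choose_mul_prod_add_mul_prod_add,
    Finset.Nat.sum_antidiagonal_eq_sum_range_succ_mk]
  refine Finset.sum_congr rfl fun b _ ↦ ?_
  rw [show k + 2 + b - 2 = k + b by omega, ← factorial_mul_two_pow_mul_choose,
    ← doubleFactOdd_eq_prod]
  ring
end

section
/- Let p : ℕ → ℝ satisfy p_j ≥ 0 for all j, p_0 > 0, p_1 = 0, and suppose the set J = {j ≥ 1 : p_{j+1} > 0} is nonempty with gcd(J) = 1. Define Q_1 = p_0 and, for k ≥ 2, Q_k = Σ_{j=2}^{k} p_j · Σ_{(k_1,…,k_j)} Q_{k_1}⋯Q_{k_j}, where the inner sum is over all j-tuples of positive integers with k_1 + ⋯ + k_j = k. Then there exists K such that Q_k > 0 for all k ≥ K. (Q_k is the probability that the terminal tree of the Galton–Watson process with offspring distribution p has exactly k leaves.) -/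
/-- The leaf count recursion with nonnegative weights has nonnegative solutions. -/
theorem leaf_count_nonneg (p Q : ℕ → ℝ) (hp : ∀ j, 0 ≤ p j) (hQ1 : Q 1 = p 0)
    (hQ : ∀ k, 2 ≤ k → Q k =
      ∑ j ∈ Finset.Icc 2 k, p j *
        ∑ t ∈ (Finset.Nat.antidiagonalTuple j k).filter (fun t => ∀ i, 0 < t i),
          ∏ i, Q (t i)) (k : ℕ) (hk : 0 < k) : 0 ≤ Q k := by
  induction k using Nat.strong_induction_on with
  | _ k ih =>
    obtain rfl | hk2 : k = 1 ∨ 2 ≤ k := by omega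
    · exact hQ1 ▸ hp 0
    rw [hQ k hk2]
    refine Finset.sum_nonneg fun j hj => mul_nonneg (hp j) (Finset.sum_nonneg fun t ht =>
      Finset.prod_nonneg fun i _ => ih _ ?_ ?_)
    · rw [Finset.mem_filter, Finset.Nat.mem_antidiagonalTuple] at ht
      obtain ⟨hsum, hpos⟩ := ht
      have : Nontrivial (Fin j) := Fin.nontrivial_iff_two_le.mpr (Finset.mem_Icc.mp hj).1
      obtain ⟨i', hi'⟩ := exists_ne i
      exact hsum ▸ Finset.single_lt_sum hi' (Finset.mem_univ i) (Finset.mem_univ i') (hpos i')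
        fun _ _ _ => Nat.zero_le _
    · exact (Finset.mem_filter.mp ht).2 i

/-- Replacing one of `n + 1` leaves by a branch vertex with `j + 1` leaf children keeps the
probability positive. -/
theorem leaf_count_pos_add (p Q : ℕ → ℝ) (hp : ∀ j, 0 ≤ p j) (hp0 : 0 < p 0) (hQ1 : Q 1 = p 0)
    (hQ : ∀ k, 2 ≤ k → Q k =
      ∑ j ∈ Finset.Icc 2 k, p j *
        ∑ t ∈ (Finset.Nat.antidiagonalTuple j k).filter (fun t => ∀ i, 0 < t i),
          ∏ i, Q (t i)) (j n : ℕ) (hj : 1 ≤ j) (hpj : 0 < p (j + 1)) (hn : 0 < Q (n + 1)) :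
    0 < Q (j + n + 1) := by
  have hnonneg := leaf_count_nonneg p Q hp hQ1 hQ
  have hprod : ∀ i k, ∀ t ∈ (Finset.Nat.antidiagonalTuple i k).filter (fun t => ∀ i, 0 < t i),
      0 ≤ ∏ i, Q (t i) := fun i k t ht =>
    Finset.prod_nonneg fun l _ => hnonneg _ ((Finset.mem_filter.mp ht).2 l)
  rw [hQ _ (by omega)]
  refine Finset.sum_pos' (fun i _ => mul_nonneg (hp i) (Finset.sum_nonneg (hprod i _)))
    ⟨j + 1, Finset.mem_Icc.mpr (by omega), mul_pos hpj (Finset.sum_pos' (hprod _ _)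
      ⟨Fin.cons (n + 1) fun _ => 1, ?_, ?_⟩)⟩
  · rw [Finset.mem_filter, Finset.Nat.mem_antidiagonalTuple]
    refine ⟨?_, fun i => ?_⟩
    · simp [Fin.sum_univ_succ]
      omega
    · refine Fin.cases ?_ (fun _ => ?_) i <;> simp
  · rw [Fin.prod_univ_succ]
    simpa [hQ1] using mul_pos hn (pow_pos hp0 j)


/-- Let `p : ℕ → ℝ` with `p_j ≥ 0`, `p_0 > 0`, `p_1 = 0`, and suppose the set
`J = {j ≥ 1 : p_{j+1} > 0}` is nonempty with `gcd J = 1` (expressed as: every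
common divisor of `J` equals `1`).  Let `Q` satisfy `Q 1 = p 0` and, for `k ≥ 2`,
`Q k = Σ_{j=2}^{k} p_j · Σ_{k_1+⋯+k_j=k, k_i ≥ 1} Q_{k_1}⋯Q_{k_j}`.
Then `Q k > 0` for all sufficiently large `k`. -/
theorem leaf_count_probability_positive (p : ℕ → ℝ) (Q : ℕ → ℝ)
    (hp : ∀ j, 0 ≤ p j) (hp0 : 0 < p 0) (hp1 : p 1 = 0)
    (hJ : ∃ j, 1 ≤ j ∧ 0 < p (j+1))
    (hgcd : ∀ d : ℕ, (∀ j, 1 ≤ j → 0 < p (j+1) → d ∣ j) → d = 1)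
    (hQ1 : Q 1 = p 0)
    (hQ : ∀ k, 2 ≤ k → Q k =
      ∑ j ∈ Finset.Icc 2 k, p j *
        ∑ t ∈ (Finset.Nat.antidiagonalTuple j k).filter (fun t => ∀ i, 0 < t i),
          ∏ i, Q (t i)) :
    ∃ K : ℕ, ∀ k, K ≤ k → 0 < Q k := by
  set J : Set ℕ := {j | 1 ≤ j ∧ 0 < p (j + 1)}
  have hgcdJ : Nat.setGcd J = 1 :=
    hgcd _ fun j hj hpj => Nat.setGcd_dvd_of_mem ⟨hj, hpj⟩
  obtain ⟨N, hN⟩ := Nat.exists_mem_closure_of_ge J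
  have hpos : ∀ m ∈ AddSubmonoid.closure J, 0 < Q (m + 1) := fun m hm => by
    induction hm using AddSubmonoid.closure_induction_left with
    | zero => simpa [hQ1] using hp0
    | add_left j hj n _ ih => exact leaf_count_pos_add p Q hp hp0 hQ1 hQ j n hj.1 hj.2 ih
  refine ⟨N + 1, fun k hk => ?_⟩
  obtain ⟨m, rfl⟩ : ∃ m, k = m + 1 := ⟨k - 1, by omega⟩
  exact hpos m (hN m (by omega) (hgcdJ ▸ one_dvd m))
end

section
/- Let p : ℕ → ℝ satisfy: p_j ≥ 0 for all j, p_0 > 0, p_1 = 0, Σ_{j≥0} p_j = 1, Σ_{j≥0} j·p_j = 1, and Σ_{j≥0} p_j·R^j < ∞ for some R > 1. Suppose (c_n)_{n≥1} is a sequence with c_n ≥ 0, Σ_{n≥1} c_n ≤ 1, such that Φ(y) := Σ_{n≥1} c_n y^n satisfies Φ(y) = Σ_{j≥0} p_j·Φ(y)^j + p_0·(y − 1) for all y ∈ [0,1). Then Σ_{n≥1} n·c_n = ∞ (the series diverges); in particular, the radius of convergence of Σ c_n y^n is exactly 1, and the expected number of leaves of the critical terminal Galton–Watson tree is infinite. 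-/
open Filter Asymptotics

theorem nonpos_of_forall_le_mul {a C : ℝ} (h : ∀ t : ℝ, 0 < t → t ≤ 1 → a ≤ C * t) : a ≤ 0 := by
  have hlim : Tendsto (fun t : ℝ => C * t) (nhdsWithin 0 (Set.Ioi 0)) (nhds 0) := by
    have := (continuous_const_mul C).tendsto 0
    rw [mul_zero] at this
    exact this.mono_left nhdsWithin_le_nhds
  refine ge_of_tendsto hlim ?_
  filter_upwards [Ioc_mem_nhdsGT one_pos] with t ht using h t ht.1 ht.2

theorem one_sub_pow_le_quadratic {v : ℝ} (h0 : 0 ≤ v) (h1 : v ≤ 1) (j : ℕ) :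
    (1 - v) ^ j ≤ 1 - j * v + (j : ℝ) ^ 2 * v ^ 2 := by
  induction j with
  | zero => simp
  | succ k ih =>
    rw [pow_succ (1 - v)]
    push_cast
    have hk : (0 : ℝ) ≤ k := k.cast_nonneg
    have h := mul_le_mul_of_nonneg_right ih (sub_nonneg.2 h1)
    have h3 : 0 ≤ (k : ℝ) ^ 2 * v ^ 3 := by positivity
    have h2 : 0 ≤ (k : ℝ) * v ^ 2 := by positivity
    nlinarith [sq_nonneg v]

theorem quadratic_le_one_sub_pow {v : ℝ} (h1 : v ≤ 1) {j : ℕ} (hj : 2 ≤ j) :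
    1 - j * v + v ^ 2 ≤ (1 - v) ^ j := by
  induction j, hj using Nat.le_induction with
  | base => apply le_of_eq; push_cast; ring
  | succ k hk ih =>
    rw [pow_succ (1 - v)]
    push_cast
    have hk' : (1 : ℝ) ≤ k := by exact_mod_cast (by omega : 1 ≤ k)
    have h := mul_le_mul_of_nonneg_right ih (sub_nonneg.2 h1)
    have h3 : 0 ≤ ((k : ℝ) - v) * v ^ 2 := mul_nonneg (by linarith) (sq_nonneg v)
    nlinarith

theorem summable_sq_mul_of_summable_mul_pow {p : ℕ → ℝ} {R : ℝ} (hR : 1 < R)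
    (h : Summable fun j : ℕ => p j * R ^ j) : Summable fun j : ℕ => (j : ℝ) ^ 2 * p j := by
  refine summable_of_isBigO_nat (g := fun j : ℕ => p j * R ^ j) h ?_
  have := (isLittleO_pow_const_const_pow_of_one_lt (R := ℝ) 2 hR).isBigO.mul
    (isBigO_refl p atTop)
  simpa only [mul_comm (p _)] using this

theorem summable_natCast_mul_of_summable_mul_pow {c : ℕ → ℝ} (hc : ∀ n, 0 ≤ c n) {y : ℝ}
    (hy : 1 < y) (h : Summable fun n : ℕ => c n * y ^ n) :
    Summable fun n : ℕ => (n : ℝ) * c n := by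
  refine Summable.of_nonneg_of_le (fun n => mul_nonneg n.cast_nonneg (hc n)) (fun n => ?_)
    (h.mul_left (y - 1)⁻¹)
  have hb := one_add_mul_sub_le_pow (a := y) (by linarith) n
  rw [inv_mul_eq_div, le_div_iff₀ (by linarith)]
  nlinarith [hc n, mul_le_mul_of_nonneg_left hb (hc n)]

theorem summable_mul_pow_of_abs_le_one {c : ℕ → ℝ} (hc : ∀ n, 0 ≤ c n) (hcS : Summable c) {y : ℝ}
    (hy : |y| ≤ 1) : Summable fun n : ℕ => c n * y ^ n := by
  refine Summable.of_norm_bounded hcS fun n => ?_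
  rw [norm_mul, norm_pow, Real.norm_of_nonneg (hc n), Real.norm_eq_abs]
  exact mul_le_of_le_one_right (hc n) (pow_le_one₀ (abs_nonneg y) hy)

/-- The second-order Taylor remainder at `1` of the generating function of a distribution with
mean `1`. -/
theorem hasSum_pgf_remainder {p : ℕ → ℝ} (hp : ∀ j, 0 ≤ p j) (hpsum : ∑' j, p j = 1)
    (hmean : ∑' j : ℕ, (j : ℝ) * p j = 1) {v : ℝ} (h0 : 0 ≤ v) (h1 : v ≤ 1) :
    HasSum (fun j : ℕ => p j * ((1 - v) ^ j - 1 + j * v))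
      (∑' j, p j * (1 - v) ^ j - 1 + v) := by
  have hs : Summable p := by
    by_contra h
    simp [tsum_eq_zero_of_not_summable h] at hpsum
  have hm : Summable fun j : ℕ => (j : ℝ) * p j := by
    by_contra h
    simp [tsum_eq_zero_of_not_summable h] at hmean
  have hF := summable_mul_pow_of_abs_le_one hp hs (y := 1 - v)
    (abs_le.2 ⟨by linarith, by linarith⟩)
  have := (hF.hasSum.sub hs.hasSum).add (hm.hasSum.mul_right v)
  rw [hpsum, hmean, one_mul] at this
  refine this.congr_fun fun j => ?_
  ring

theorem pgf_remainder_le {p : ℕ → ℝ} (hp : ∀ j, 0 ≤ p j) (hpsum : ∑' j, p j = 1)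
    (hmean : ∑' j : ℕ, (j : ℝ) * p j = 1) (hsq : Summable fun j : ℕ => (j : ℝ) ^ 2 * p j)
    {v : ℝ} (h0 : 0 ≤ v) (h1 : v ≤ 1) :
    ∑' j, p j * (1 - v) ^ j - 1 + v ≤ (∑' j : ℕ, (j : ℝ) ^ 2 * p j) * v ^ 2 := by
  refine hasSum_le (fun j => ?_) (hasSum_pgf_remainder hp hpsum hmean h0 h1)
    (hsq.hasSum.mul_right (v ^ 2))
  nlinarith [mul_le_mul_of_nonneg_left (one_sub_pow_le_quadratic h0 h1 j) (hp j)]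

theorem le_pgf_remainder {p : ℕ → ℝ} (hp : ∀ j, 0 ≤ p j) (hpsum : ∑' j, p j = 1)
    (hmean : ∑' j : ℕ, (j : ℝ) * p j = 1) {k : ℕ} (hk : 2 ≤ k) {v : ℝ} (h0 : 0 ≤ v)
    (h1 : v ≤ 1) : p k * v ^ 2 ≤ ∑' j, p j * (1 - v) ^ j - 1 + v := by
  refine le_trans ?_ (le_hasSum (hasSum_pgf_remainder hp hpsum hmean h0 h1) k fun j _ => ?_)
  · exact mul_le_mul_of_nonneg_left (by linarith [quadratic_le_one_sub_pow h1 hk]) (hp k)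
  · have := one_add_mul_sub_le_pow (a := 1 - v) (by linarith) j
    exact mul_nonneg (hp j) (by linarith)

theorem exists_two_le_pos_of_mean_eq_one {p : ℕ → ℝ} (hp : ∀ j, 0 ≤ p j) (hp1 : p 1 = 0)
    (hmean : ∑' j : ℕ, (j : ℝ) * p j = 1) : ∃ k, 2 ≤ k ∧ 0 < p k := by
  by_contra! h
  have hz : ∀ j : ℕ, (j : ℝ) * p j = 0 := by
    rintro (_ | _ | j)
    · simp
    · simp [hp1]
    · rw [le_antisymm (h (j + 2) (by omega)) (hp _), mul_zero]
  simp [hz] at hmean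

theorem tsum_mul_pow_le_tsum {c : ℕ → ℝ} (hc : ∀ n, 0 ≤ c n) (hcS : Summable c) {y : ℝ}
    (h0 : 0 ≤ y) (h1 : y ≤ 1) : ∑' n, c n * y ^ n ≤ ∑' n, c n :=
  (summable_mul_pow_of_abs_le_one hc hcS (by rwa [abs_of_nonneg h0])).tsum_le_tsum
    (fun n => mul_le_of_le_one_right (hc n) (pow_le_one₀ h0 h1)) hcS

theorem tsum_sub_tsum_mul_pow_le {c : ℕ → ℝ} (hc : ∀ n, 0 ≤ c n) (hcS : Summable c)
    (hM : Summable fun n : ℕ => (n : ℝ) * c n) {y : ℝ} (h0 : 0 ≤ y) (h1 : y ≤ 1) :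
    ∑' n, c n - ∑' n, c n * y ^ n ≤ (∑' n : ℕ, (n : ℝ) * c n) * (1 - y) := by
  have hs := summable_mul_pow_of_abs_le_one hc hcS (by rwa [abs_of_nonneg h0])
  refine hasSum_le (fun n => ?_) (hcS.hasSum.sub hs.hasSum) (hM.hasSum.mul_right (1 - y))
  have hb := one_add_mul_sub_le_pow (a := y) (by linarith) n
  nlinarith [mul_le_mul_of_nonneg_left hb (hc n)]


/-- The expected number of leaves of the critical terminal Galton–Watson tree is infinite:
`Σ_n n·c_n` diverges; in particular the radius of convergence of `Σ c_n y^n` is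
exactly `1` (it converges for `|y| < 1` and diverges for `y > 1`). -/
theorem expected_leaves_infinite (p : ℕ → ℝ) (c : ℕ → ℝ)
    (hp : ∀ j, 0 ≤ p j) (hp0 : 0 < p 0) (hp1 : p 1 = 0)
    (hpsum : ∑' j, p j = 1)
    (hmean : ∑' j : ℕ, (j : ℝ) * p j = 1)
    (R : ℝ) (hR : 1 < R) (hRsum : Summable (fun j : ℕ => p j * R^j))
    (hc0 : c 0 = 0) (hc : ∀ n, 0 ≤ c n) (hcS : Summable c) (hcle : ∑' n, c n ≤ 1)
    (hΦ : ∀ y ∈ Set.Ico (0:ℝ) 1,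
      (∑' n, c n * y^n) = (∑' j, p j * (∑' n, c n * y^n)^j) + p 0 * (y - 1)) :
    ¬ Summable (fun n : ℕ => (n : ℝ) * c n) ∧
    (∀ y : ℝ, |y| < 1 → Summable (fun n : ℕ => c n * y^n)) ∧
    (∀ y : ℝ, 1 < y → ¬ Summable (fun n : ℕ => c n * y^n)) := by
  have hdiv : ¬ Summable fun n : ℕ => (n : ℝ) * c n := by
    intro hM
    obtain ⟨k, hk, hpk⟩ := exists_two_le_pos_of_mean_eq_one hp hp1 hmean
    have hsq := summable_sq_mul_of_summable_mul_pow hR hRsum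
    set S := ∑' n, c n
    set K := ∑' j : ℕ, (j : ℝ) ^ 2 * p j
    set M := ∑' n : ℕ, (n : ℝ) * c n
    have hK : 0 ≤ K := tsum_nonneg fun j => mul_nonneg (sq_nonneg _) (hp j)
    -- Parametrise by `t = 1 - y` and `v = 1 - Φ y`.
    have key : ∀ t : ℝ, 0 < t → t ≤ 1 → ∃ v, 1 - S ≤ v ∧ v ≤ 1 - S + M * t ∧
        p k * v ^ 2 ≤ p 0 * t ∧ p 0 * t ≤ K * v ^ 2 := by
      intro t ht0 ht1
      have hy0 : 0 ≤ 1 - t := by linarith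
      have hy1 : 1 - t ≤ 1 := by linarith
      have hle := tsum_mul_pow_le_tsum hc hcS hy0 hy1
      have hge := tsum_sub_tsum_mul_pow_le hc hcS hM hy0 hy1
      have heq := hΦ (1 - t) ⟨hy0, by linarith⟩
      have hnn : 0 ≤ ∑' n, c n * (1 - t) ^ n :=
        tsum_nonneg fun n => mul_nonneg (hc n) (pow_nonneg hy0 n)
      set x := ∑' n, c n * (1 - t) ^ n
      have hv0 : 0 ≤ 1 - x := by linarith
      have hv1 : 1 - x ≤ 1 := by linarith
      have hlo := le_pgf_remainder hp hpsum hmean hk hv0 hv1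
      have hup := pgf_remainder_le hp hpsum hmean hsq hv0 hv1
      rw [sub_sub_cancel] at hlo hup
      refine ⟨1 - x, by linarith, by linarith, by linarith, by linarith⟩
    have hS : S = 1 := by
      refine le_antisymm hcle (sub_nonpos.1 (pow_eq_zero_iff two_ne_zero |>.1 ?_).le)
      have hbd : p k * (1 - S) ^ 2 ≤ 0 := by
        refine nonpos_of_forall_le_mul (C := p 0) fun t ht0 ht1 => ?_
        obtain ⟨v, hv, -, hlo, -⟩ := key t ht0 ht1
        refine le_trans (mul_le_mul_of_nonneg_left ?_ hpk.le) hlo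
        exact pow_le_pow_left₀ (sub_nonneg.2 hcle) hv 2
      exact le_antisymm (nonpos_of_mul_nonpos_right hbd hpk) (sq_nonneg _)
    have hbd : p 0 ≤ 0 := by
      refine nonpos_of_forall_le_mul (C := K * M ^ 2) fun t ht0 ht1 => ?_
      obtain ⟨v, hv, hv', -, hup⟩ := key t ht0 ht1
      rw [hS, sub_self] at hv hv'
      rw [zero_add] at hv'
      refine le_of_mul_le_mul_right ?_ ht0
      calc p 0 * t ≤ K * v ^ 2 := hup
        _ ≤ K * (M * t) ^ 2 := by gcongr
        _ = K * M ^ 2 * t * t := by ring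
    exact hbd.not_gt hp0
  exact ⟨hdiv, fun y hy => summable_mul_pow_of_abs_le_one hc hcS hy.le,
    fun y hy hs => hdiv (summable_natCast_mul_of_summable_mul_pow hc hy hs)⟩
end

section
/- Let q : ℕ → ℝ satisfy q_j ≥ 0 for all j ≥ 2, Σ_{j≥2} j·q_j < 1, q_0 := 1 − Σ_{j≥2} q_j > 0, and Σ_{j≥2} q_j·R^j < ∞ for some R > 1. Suppose (c_n)_{n≥1} is a sequence with c_n ≥ 0, Σ_{n≥1} c_n ≤ 1, such that Ψ(y) := Σ_{n≥1} c_n y^n satisfies Ψ(y) = Σ_{j≥2} q_j·Ψ(y)^j + q_0·y for all y ∈ [0,1). Then for every integer a ≥ 1 and every real ρ with 0 < ρ < R and Σ_{j≥2} q_j·ρ^{j−1} < 1, one has c_a ≤ q_0^a · ρ / (a · (ρ − Σ_{j≥2} q_j·ρ^j)^a). -/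
open Filter Topology in
/-- A real power series whose sum vanishes on `[0, 1)` has zero coefficients. -/
theorem coeff_eq_zero_of_hasSum_zero {d : ℕ → ℝ}
    (h : ∀ y ∈ Set.Ico (0 : ℝ) 1, HasSum (fun n => d n * y ^ n) 0) : d = 0 := by
  have hs := (h (1 / 2) ⟨by norm_num, by norm_num⟩).summable.norm
  have hsum : ∀ y : ℝ, |y| < 1 / 2 → Summable fun n => y ^ n • d n := by
    intro y hy
    refine Summable.of_norm_bounded hs fun n => ?_
    rw [norm_smul, norm_mul, norm_pow, norm_pow, mul_comm, Real.norm_eq_abs y,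
      Real.norm_of_nonneg (by norm_num : (0 : ℝ) ≤ 1 / 2)]
    gcongr
  have hf : HasFPowerSeriesAt (fun y : ℝ => ∑' n, y ^ n • d n)
      (FormalMultilinearSeries.ofScalars ℝ d) 0 := by
    rw [hasFPowerSeriesAt_iff]
    filter_upwards [Metric.ball_mem_nhds (0 : ℝ) (by norm_num : (0 : ℝ) < 1 / 2)] with y hy
    rw [mem_ball_zero_iff, Real.norm_eq_abs] at hy
    simpa [FormalMultilinearSeries.coeff_ofScalars] using (hsum y hy).hasSum
  have hfreq : ∃ᶠ y in 𝓝[≠] (0 : ℝ), (∑' n, y ^ n • d n) = (fun _ => (0 : ℝ)) y := by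
    have hev : ∀ᶠ y in 𝓝[>] (0 : ℝ), (∑' n, y ^ n • d n) = (fun _ => (0 : ℝ)) y := by
      filter_upwards [Ioo_mem_nhdsGT (zero_lt_one' ℝ)] with y hy
      simpa [mul_comm] using (h y ⟨hy.1.le, hy.2⟩).tsum_eq
    exact hev.frequently.filter_mono (nhdsWithin_mono _ fun y hy => ne_of_gt hy)
  rw [AnalyticAt.frequently_eq_iff_eventually_eq hf.analyticAt analyticAt_const] at hfreq
  have hz := (hf.congr hfreq).eq_zero
  exact (FormalMultilinearSeries.ofScalars_series_eq_zero ℝ).1 hz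

/-- The Cauchy product of two unconditionally convergent real series. -/
theorem hasSum_sum_antidiagonal_mul {F G : ℕ → ℝ} {A B : ℝ} (hF : HasSum F A) (hG : HasSum G B) :
    HasSum (fun n => ∑ p ∈ Finset.HasAntidiagonal.antidiagonal n, F p.1 * G p.2) (A * B) := by
  have hs := summable_mul_of_summable_norm hF.summable.norm hG.summable.norm
  rw [← hF.tsum_eq, ← hG.tsum_eq,
    hF.summable.tsum_mul_tsum_eq_tsum_sum_antidiagonal hG.summable hs]
  exact (summable_sum_mul_antidiagonal_of_summable_mul hs).hasSum

namespace PowerSeries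

theorem coeff_mul_nonneg {f g : PowerSeries ℝ} (hf : ∀ n, 0 ≤ coeff n f)
    (hg : ∀ n, 0 ≤ coeff n g) (n : ℕ) : 0 ≤ coeff n (f * g) := by
  rw [coeff_mul]
  exact Finset.sum_nonneg fun p _ => mul_nonneg (hf _) (hg _)

theorem coeff_pow_nonneg {f : PowerSeries ℝ} (hf : ∀ n, 0 ≤ coeff n f) (k n : ℕ) :
    0 ≤ coeff n (f ^ k) := by
  induction k generalizing n with
  | zero => rw [pow_zero, coeff_one]; split_ifs <;> norm_num
  | succ k ih => rw [pow_succ]; exact coeff_mul_nonneg ih hf n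

theorem coeff_mul_mul_pow {R : Type*} [CommSemiring R] (f g : PowerSeries R) (y : R) (n : ℕ) :
    coeff n (f * g) * y ^ n = ∑ p ∈ Finset.HasAntidiagonal.antidiagonal n,
      (coeff p.1 f * y ^ p.1) * (coeff p.2 g * y ^ p.2) := by
  rw [coeff_mul, Finset.sum_mul]
  refine Finset.sum_congr rfl fun p hp => ?_
  rw [← Finset.HasAntidiagonal.mem_antidiagonal.1 hp, pow_add]
  ring

theorem hasSum_mul {f g : PowerSeries ℝ} {y A B : ℝ}
    (hA : HasSum (fun n => coeff n f * y ^ n) A) (hB : HasSum (fun n => coeff n g * y ^ n) B) :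
    HasSum (fun n => coeff n (f * g) * y ^ n) (A * B) := by
  have hcauchy := hasSum_sum_antidiagonal_mul hA hB
  convert hcauchy using 2 with n
  exact coeff_mul_mul_pow f g y n

theorem hasSum_pow {f : PowerSeries ℝ} {y A : ℝ}
    (hA : HasSum (fun n => coeff n f * y ^ n) A) (k : ℕ) :
    HasSum (fun n => coeff n (f ^ k) * y ^ n) (A ^ k) := by
  induction k with
  | zero =>
    simp only [pow_zero, coeff_one]
    convert hasSum_ite_eq (0 : ℕ) (1 : ℝ) using 2 with n
    split_ifs with h <;> simp [h]
  | succ k ih =>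
    simp only [pow_succ f, pow_succ A]
    exact hasSum_mul ih hA

theorem coeff_pow_eq_zero_of_lt {R : Type*} [CommSemiring R] {f : PowerSeries R}
    (hf : constantCoeff f = 0) {k n : ℕ} (h : n < k) : coeff n (f ^ k) = 0 :=
  X_pow_dvd_iff.1 (pow_dvd_pow_of_dvd (X_dvd_iff.2 hf) k) n h

theorem hasSum_subst {f g : PowerSeries ℝ} (hf : ∀ n, 0 ≤ coeff n f) (hg : ∀ n, 0 ≤ coeff n g)
    (hg0 : constantCoeff g = 0) {y A B : ℝ} (hy : 0 ≤ y)
    (hA : HasSum (fun n => coeff n g * y ^ n) A) (hB : HasSum (fun d => coeff d f * A ^ d) B) :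
    HasSum (fun n => coeff n (f.subst g) * y ^ n) B := by
  have hrow : ∀ d, HasSum (fun n => coeff d f * (coeff n (g ^ d) * y ^ n)) (coeff d f * A ^ d) :=
    fun d => (hasSum_pow hA d).mul_left _
  have hs : Summable fun p : ℕ × ℕ => coeff p.1 f * (coeff p.2 (g ^ p.1) * y ^ p.2) := by
    refine (summable_prod_of_nonneg fun p => mul_nonneg (hf _)
      (mul_nonneg (coeff_pow_nonneg hg _ _) (pow_nonneg hy _))).2 ⟨fun d => (hrow d).summable, ?_⟩
    simpa only [(hrow _).tsum_eq] using hB.summable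
  have htot := hs.hasSum
  rw [(htot.prod_fiberwise hrow).unique hB] at htot
  rw [← (Equiv.prodComm ℕ ℕ).hasSum_iff] at htot
  refine htot.prod_fiberwise fun n => ?_
  have hsupp : ∀ d ∉ Finset.range (n + 1), coeff d f * coeff n (g ^ d) = 0 := fun d hd => by
    rw [coeff_pow_eq_zero_of_lt hg0 (by simpa using hd), mul_zero]
  have hcoeff : coeff n (f.subst g) = ∑ d ∈ Finset.range (n + 1), coeff d f * coeff n (g ^ d) := by
    rw [coeff_subst' (HasSubst.of_constantCoeff_zero' hg0)]
    refine finsum_eq_sum_of_support_subset _ fun d hd => ?_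
    by_contra hd'
    exact hd (hsupp d hd')
  rw [hcoeff]
  simpa only [Function.comp_apply, Equiv.prodComm_apply, Prod.swap, mul_assoc] using
    (hasSum_sum_of_ne_finset_zero hsupp).mul_right (y ^ n)

/-- Lagrange inversion: if `f = X · φ(f)` then `n [Xⁿ] fᵏ = k [Xⁿ⁻ᵏ] φⁿ`. -/
theorem lagrange_inversion {K : Type*} [Field K] [CharZero K] {f φ : PowerSeries K}
    (hf : constantCoeff f = 0) (hfφ : f = X * φ.subst f) (m k : ℕ) :
    ((m + k : ℕ) : K) * coeff (m + k) (f ^ k) = k * coeff m (φ ^ (m + k)) := by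
  have hs : HasSubst f := HasSubst.of_constantCoeff_zero' hf
  induction m using Nat.strong_induction_on generalizing k with
  | _ m ih =>
    have hpow : coeff (m + k) (f ^ k) = coeff m ((φ ^ k).subst f) := by
      conv_lhs => rw [hfφ, mul_pow, ← subst_pow hs]
      rw [coeff_X_pow_mul]
    rcases Nat.eq_zero_or_pos m with rfl | hm
    · rw [hpow, coeff_subst' hs, finsum_eq_single _ 0]
      · simp
      · intro d hd
        rw [coeff_pow_eq_zero_of_lt hf (Nat.pos_of_ne_zero hd), smul_zero]
    · have hm0 : (m : K) ≠ 0 := Nat.cast_ne_zero.2 hm.ne'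
      have hexp : (m : K) * coeff m ((φ ^ k).subst f) =
          ∑ p ∈ Finset.HasAntidiagonal.antidiagonal m, p.1 * (coeff p.1 (φ ^ k) * coeff p.2 (φ ^ m)) := by
        rw [coeff_subst' hs, finsum_eq_sum_of_support_subset (s := Finset.range (m + 1)),
          Finset.Nat.sum_antidiagonal_eq_sum_range_succ_mk, Finset.mul_sum]
        · refine Finset.sum_congr rfl fun d hd => ?_
          have hd' : d ≤ m := Nat.lt_succ_iff.1 (Finset.mem_range.1 hd)
          rcases Nat.eq_zero_or_pos d with rfl | hd0
          · simp [hm.ne']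
          · have := ih (m - d) (by omega) d
            rw [Nat.sub_add_cancel hd'] at this
            rw [smul_eq_mul, mul_left_comm, this]
            ring
        · intro d hd
          by_contra hd'
          exact hd (by simp [coeff_pow_eq_zero_of_lt hf (show m < d by simpa using hd')])
      have hder : ((m + k : ℕ) : K) *
          ∑ p ∈ Finset.HasAntidiagonal.antidiagonal m, p.1 * (coeff p.1 (φ ^ k) * coeff p.2 (φ ^ m)) =
          m * (k * coeff m (φ ^ (m + k))) := by
        have hX : ∀ (u : PowerSeries K) (n : ℕ), coeff n (X * derivative K u) = n * coeff n u := by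
          intro u n
          cases n with
          | zero => simp
          | succ n => rw [coeff_succ_X_mul, coeff_derivative]; push_cast; ring
        have hprod : ((m + k : ℕ) : PowerSeries K) * (X * derivative K (φ ^ k) * φ ^ m) =
            (k : PowerSeries K) * (X * derivative K (φ ^ (m + k))) := by
          rcases Nat.eq_zero_or_pos k with rfl | hk
          · simp
          · rw [derivative_pow, derivative_pow, show m + k - 1 = (k - 1) + m by omega, pow_add]
            ring
        have := congrArg (coeff m) hprod
        rw [← map_natCast (C (R := K)), ← map_natCast (C (R := K)), coeff_C_mul, coeff_C_mul, hX,
          coeff_mul] at this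
        simp only [hX, mul_assoc] at this
        rw [this]
        ring
      rw [hpow]
      apply mul_left_cancel₀ hm0
      rw [mul_left_comm, hexp, hder]

theorem sum_range_coeff_mul_le {f g : PowerSeries ℝ} (hf : ∀ n, 0 ≤ coeff n f)
    (hg : ∀ n, 0 ≤ coeff n g) {ρ : ℝ} (hρ : 0 ≤ ρ) (N : ℕ) :
    ∑ n ∈ Finset.range N, coeff n (f * g) * ρ ^ n ≤
      (∑ n ∈ Finset.range N, coeff n f * ρ ^ n) * ∑ n ∈ Finset.range N, coeff n g * ρ ^ n := by
  simp only [coeff_mul_mul_pow]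
  have hinj : Set.InjOn Sigma.snd (((Finset.range N).sigma fun n =>
      Finset.HasAntidiagonal.antidiagonal n : Finset (Σ _ : ℕ, ℕ × ℕ)) : Set (Σ _ : ℕ, ℕ × ℕ)) := by
    rintro ⟨n, p⟩ hp ⟨n', p'⟩ hp' rfl
    simp_all
  rw [Finset.sum_mul_sum, ← Finset.sum_product', Finset.sum_sigma',
    ← Finset.sum_image (f := fun p : ℕ × ℕ => coeff p.1 f * ρ ^ p.1 * (coeff p.2 g * ρ ^ p.2)) hinj]
  refine Finset.sum_le_sum_of_subset_of_nonneg (fun p hp => ?_) fun p _ _ =>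
    mul_nonneg (mul_nonneg (hf _) (pow_nonneg hρ _)) (mul_nonneg (hg _) (pow_nonneg hρ _))
  obtain ⟨⟨n, p'⟩, hx, rfl⟩ := Finset.mem_image.1 hp
  simp only [Finset.mem_sigma, Finset.mem_range, Finset.HasAntidiagonal.mem_antidiagonal] at hx
  simp only [Finset.mem_product, Finset.mem_range]
  omega

theorem sum_range_coeff_pow_le {f : PowerSeries ℝ} (hf : ∀ n, 0 ≤ coeff n f)
    {ρ B : ℝ} (hρ : 0 ≤ ρ) (N : ℕ) (hB : ∑ n ∈ Finset.range N, coeff n f * ρ ^ n ≤ B) (k : ℕ) :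
    ∑ n ∈ Finset.range N, coeff n (f ^ k) * ρ ^ n ≤ B ^ k := by
  have hnn : ∀ {u : PowerSeries ℝ}, (∀ n, 0 ≤ coeff n u) →
      0 ≤ ∑ n ∈ Finset.range N, coeff n u * ρ ^ n := fun hu =>
    Finset.sum_nonneg fun n _ => mul_nonneg (hu n) (pow_nonneg hρ n)
  induction k with
  | zero =>
    simp only [pow_zero, coeff_one, ite_mul, one_mul, zero_mul, Finset.sum_ite_eq']
    split_ifs <;> simp
  | succ k ih =>
    rw [pow_succ, pow_succ]
    refine (sum_range_coeff_mul_le (coeff_pow_nonneg hf k) hf hρ N).trans ?_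
    exact mul_le_mul ih hB (hnn hf) ((hnn (coeff_pow_nonneg hf k)).trans ih)

theorem coeff_inv_one_sub_nonneg {h : PowerSeries ℝ} (hh : ∀ n, 0 ≤ coeff n h)
    (h0 : constantCoeff h = 0) (n : ℕ) : 0 ≤ coeff n (1 - h)⁻¹ := by
  have hu : (1 - h)⁻¹ = 1 + h * (1 - h)⁻¹ := by
    have := PowerSeries.mul_inv_cancel (1 - h) (by simp [h0])
    linear_combination this
  induction n using Nat.strong_induction_on with
  | _ n ih =>
    rw [hu, map_add, coeff_mul]
    refine add_nonneg ?_ (Finset.sum_nonneg fun p hp => ?_)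
    · rw [coeff_one]; split_ifs <;> norm_num
    · rcases Nat.eq_zero_or_pos p.1 with hp0 | hp0
      · simp [hp0, h0]
      · refine mul_nonneg (hh _) (ih _ ?_)
        have := Finset.HasAntidiagonal.mem_antidiagonal.1 hp
        omega

theorem sum_range_coeff_inv_one_sub_le {h : PowerSeries ℝ} (hh : ∀ n, 0 ≤ coeff n h)
    (h0 : constantCoeff h = 0) {ρ B : ℝ} (hρ : 0 ≤ ρ) (hB1 : B < 1) (N : ℕ)
    (hB : ∑ n ∈ Finset.range N, coeff n h * ρ ^ n ≤ B) :
    ∑ n ∈ Finset.range N, coeff n (1 - h)⁻¹ * ρ ^ n ≤ (1 - B)⁻¹ := by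
  have hu : (1 - h)⁻¹ = 1 + h * (1 - h)⁻¹ := by
    have := PowerSeries.mul_inv_cancel (1 - h) (by simp [h0])
    linear_combination this
  have hun := coeff_inv_one_sub_nonneg hh h0
  have hmul := sum_range_coeff_mul_le hh hun hρ N
  set S := ∑ n ∈ Finset.range N, coeff n (1 - h)⁻¹ * ρ ^ n with hS
  have hS0 : 0 ≤ S := Finset.sum_nonneg fun n _ => mul_nonneg (hun n) (pow_nonneg hρ n)
  have hone := sum_range_coeff_pow_le hh hρ N hB 0
  have hle : S ≤ 1 + B * S := by
    rw [hS]
    conv_lhs => rw [hu]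
    simp only [map_add, add_mul, Finset.sum_add_distrib]
    rw [pow_zero, pow_zero] at hone
    exact add_le_add hone (hmul.trans (mul_le_mul_of_nonneg_right hB hS0))
  rw [← one_div, le_div_iff₀ (by linarith)]
  linarith

end PowerSeries

/-- Chernoff-type bound for the leaf-count probabilities of a subcritical
Galton–Watson process with offspring distribution `(q_0, 0, q_2, q_3, …)`,
`q_0 = 1 − Σ_{j≥2} q_j`: if `Ψ(y) = Σ c_n y^n` satisfies
`Ψ(y) = Σ_{j≥2} q_j Ψ(y)^j + q_0 y` on `[0,1)`, then for `a ≥ 1`, `0 < ρ < R`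
with `Σ_{j≥2} q_j ρ^{j−1} < 1`:
`c_a ≤ q_0^a·ρ/(a·(ρ − Σ_{j≥2} q_j ρ^j)^a)`. -/
theorem subcritical_leaf_count_bound (q : ℕ → ℝ) (c : ℕ → ℝ)
    (hq : ∀ j : ℕ, 0 ≤ q (j+2))
    (hq1 : q 1 = 0)
    (hqS : Summable (fun j : ℕ => q (j+2)))
    (hmean : ∑' j : ℕ, ((j : ℝ) + 2) * q (j+2) < 1)
    (hq0 : q 0 = 1 - ∑' j : ℕ, q (j+2)) (hq0pos : 0 < q 0)
    (R : ℝ) (hR : 1 < R) (hRsum : Summable (fun j : ℕ => q (j+2) * R^(j+2)))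
    (hc0 : c 0 = 0) (hc : ∀ n, 0 ≤ c n) (hcS : Summable c) (hcle : ∑' n, c n ≤ 1)
    (hΨ : ∀ y ∈ Set.Ico (0:ℝ) 1,
      (∑' n, c n * y^n) = (∑' j : ℕ, q (j+2) * (∑' n, c n * y^n)^(j+2)) + q 0 * y) :
    ∀ a : ℕ, 1 ≤ a → ∀ ρ : ℝ, 0 < ρ → ρ < R →
      (∑' j : ℕ, q (j+2) * ρ^(j+1)) < 1 →
      c a ≤ q 0^a * ρ / ((a : ℝ) * (ρ - ∑' j : ℕ, q (j+2) * ρ^(j+2))^a) := by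
  intro a ha ρ hρ hρR hlt
  set P : PowerSeries ℝ := PowerSeries.mk c with hP
  set h : PowerSeries ℝ := PowerSeries.mk fun m => q (m + 1) with hh
  have hPn : ∀ n, 0 ≤ PowerSeries.coeff n P := fun n => by simpa [hP] using hc n
  have hhn : ∀ n, 0 ≤ PowerSeries.coeff n h := by
    intro n
    cases n with
    | zero => simp [hh, hq1]
    | succ n => simpa [hh] using hq n
  have hP0 : PowerSeries.constantCoeff P = 0 := by
    rw [← PowerSeries.coeff_zero_eq_constantCoeff_apply]; simp [hP, hc0]
  have hh0 : PowerSeries.constantCoeff h = 0 := by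
    rw [← PowerSeries.coeff_zero_eq_constantCoeff_apply]; simp [hh, hq1]
  have hPs : PowerSeries.HasSubst P := PowerSeries.HasSubst.of_constantCoeff_zero' hP0
  have hXh : ∀ n, 0 ≤ PowerSeries.coeff n (PowerSeries.X * h) := by
    intro n
    cases n with
    | zero => simp
    | succ n => simpa [PowerSeries.coeff_succ_X_mul] using hhn n
  have hfun : P = (PowerSeries.X * h).subst P + PowerSeries.C (q 0) * PowerSeries.X := by
    rw [← sub_eq_zero]
    ext n
    refine congrFun (coeff_eq_zero_of_hasSum_zero (d := fun n => PowerSeries.coeff n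
      (P - ((PowerSeries.X * h).subst P + PowerSeries.C (q 0) * PowerSeries.X))) ?_) n
    intro y hy
    have hle : ∀ n, c n * y ^ n ≤ c n := fun n =>
      mul_le_of_le_one_right (hc n) (pow_le_one₀ hy.1 hy.2.le)
    have hnn : ∀ n, 0 ≤ c n * y ^ n := fun n => mul_nonneg (hc n) (pow_nonneg hy.1 n)
    have hs : Summable fun n => c n * y ^ n := Summable.of_nonneg_of_le hnn hle hcS
    have hA0 : 0 ≤ ∑' n, c n * y ^ n := tsum_nonneg hnn
    have hA1 : ∑' n, c n * y ^ n ≤ 1 := (hs.tsum_le_tsum hle hcS).trans hcle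
    have heq := hΨ y hy
    set A := ∑' n, c n * y ^ n with hA
    have hPA : HasSum (fun n => PowerSeries.coeff n P * y ^ n) A := by
      simpa [hP] using hs.hasSum
    have hqA : Summable fun j => q (j + 2) * A ^ (j + 2) :=
      Summable.of_nonneg_of_le (fun j => mul_nonneg (hq j) (pow_nonneg hA0 _))
        (fun j => mul_le_of_le_one_right (hq j) (pow_le_one₀ hA0 hA1)) hqS
    have hXA : HasSum (fun d => PowerSeries.coeff d (PowerSeries.X * h) * A ^ d)
        (∑' j, q (j + 2) * A ^ (j + 2)) := by
      rw [← hasSum_nat_add_iff' 2]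
      simpa [Finset.sum_range_succ, PowerSeries.coeff_succ_X_mul, hq1, hh] using hqA.hasSum
    have hX : HasSum (fun n => PowerSeries.coeff n
        (PowerSeries.C (q 0) * PowerSeries.X : PowerSeries ℝ) * y ^ n) (q 0 * y) := by
      convert hasSum_ite_eq (1 : ℕ) (q 0 * y) using 2 with n
      rw [PowerSeries.coeff_C_mul, PowerSeries.coeff_X]
      split_ifs with hn <;> simp [hn]
    have := hPA.sub ((PowerSeries.hasSum_subst hXh hPn hP0 hy.1 hPA hXA).add hX)
    rw [← heq, sub_self] at this
    simpa only [map_sub, map_add, sub_mul, add_mul] using this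
  have hlag : P = PowerSeries.X * (PowerSeries.C (q 0) * (1 - h)⁻¹).subst P := by
    have hinv : (1 - h)⁻¹ * (1 - h) = 1 := PowerSeries.inv_mul_cancel _ (by simp [hh0])
    have hinv' := congrArg (PowerSeries.substAlgHom (R := ℝ) hPs) hinv
    rw [← PowerSeries.coe_substAlgHom hPs] at hfun ⊢
    simp only [map_mul, map_sub, map_one, PowerSeries.substAlgHom_X] at hfun hinv' ⊢
    have hC : PowerSeries.substAlgHom (R := ℝ) hPs (PowerSeries.C (q 0)) =
        PowerSeries.C (q 0) := (PowerSeries.substAlgHom hPs).commutes (q 0)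
    rw [hC]
    linear_combination (PowerSeries.substAlgHom (R := ℝ) hPs (1 - h)⁻¹) * hfun - P * hinv'
  have hsum : Summable fun j => q (j + 2) * ρ ^ (j + 1) := by
    refine Summable.of_nonneg_of_le (fun j => mul_nonneg (hq j) (by positivity)) (fun j => ?_)
      (hRsum.mul_left ρ⁻¹)
    rw [mul_left_comm]
    refine mul_le_mul_of_nonneg_left ?_ (hq j)
    rw [inv_mul_eq_div, le_div_iff₀ hρ, ← pow_succ]
    exact pow_le_pow_left₀ hρ.le hρR.le _
  set B := ∑' j : ℕ, q (j + 2) * ρ ^ (j + 1) with hBdef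
  have hρB : ∑' j : ℕ, q (j + 2) * ρ ^ (j + 2) = ρ * B := by
    rw [hBdef, ← tsum_mul_left]
    exact tsum_congr fun j => by ring
  have hhB : HasSum (fun n => PowerSeries.coeff n h * ρ ^ n) B := by
    rw [← hasSum_nat_add_iff' 1]
    simpa [hh, hh0, hq1] using hsum.hasSum
  have hun := PowerSeries.coeff_inv_one_sub_nonneg hhn hh0
  obtain ⟨m, rfl⟩ : ∃ m, a = m + 1 := ⟨a - 1, by omega⟩
  have hpart := PowerSeries.sum_range_coeff_pow_le hun hρ.le (m + 1)
    (PowerSeries.sum_range_coeff_inv_one_sub_le hhn hh0 hρ.le hlt (m + 1)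
      (sum_le_hasSum _ (fun n _ => mul_nonneg (hhn n) (by positivity)) hhB)) (m + 1)
  have hcoef := (Finset.single_le_sum (f := fun n =>
    PowerSeries.coeff n ((1 - h)⁻¹ ^ (m + 1)) * ρ ^ n) (fun n _ => mul_nonneg
      (PowerSeries.coeff_pow_nonneg hun _ n) (by positivity)) (Finset.self_mem_range_succ m)).trans
    hpart
  have hL := PowerSeries.lagrange_inversion hP0 hlag m 1
  rw [pow_one, mul_pow, ← map_pow, PowerSeries.coeff_C_mul, hP, PowerSeries.coeff_mk, Nat.cast_one,
    one_mul] at hL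
  have hB : 0 < 1 - B := by linarith
  rw [hρB, show ρ - ρ * B = ρ * (1 - B) by ring, le_div_iff₀ (by positivity)]
  rw [inv_pow, ← one_div, le_div_iff₀ (by positivity)] at hcoef
  calc c (m + 1) * (((m + 1 : ℕ) : ℝ) * (ρ * (1 - B)) ^ (m + 1))
      = (((m + 1 : ℕ) : ℝ) * c (m + 1)) * (ρ * (1 - B)) ^ (m + 1) := by ring
    _ = q 0 ^ (m + 1) * ρ * (PowerSeries.coeff m ((1 - h)⁻¹ ^ (m + 1)) * ρ ^ m *
          (1 - B) ^ (m + 1)) := by rw [hL, mul_pow]; ring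
    _ ≤ q 0 ^ (m + 1) * ρ := mul_le_of_le_one_right (by positivity) hcoef
end

section
/- For every ε ∈ (0, 1/2] there exists N such that for all integers n ≥ N and all integers a with a ≥ (1 + ε)·(e/2)·n^{1/2}, one has binom(n, a) / (2^{a−1}·(2a − 3)!!) ≤ (1 − ε)^a. (The quantity binom(n,a)/(2^{a−1}(2a−3)!!) is the expected number of common leaf-sets of size a inducing the same subtree in two independent copies of the uniformly random ordered rooted binary tree with n labelled leaves; hence a maximum agreement subtree of two such trees is likely to have at most (1+o(1))·(e/2)·n^{1/2} leaves.) -/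
theorem two_pow_mul_doubleFactOdd_mul_factorial (m : ℕ) :
    2 ^ m * doubleFactOdd m * m.factorial = (2 * m).factorial := by
  induction m with
  | zero => simp [doubleFactOdd]
  | succ m ih =>
    rw [show 2 * (m + 1) = 2 * m + 1 + 1 by ring, Nat.factorial_succ (2 * m + 1),
      Nat.factorial_succ (2 * m), ← ih, Nat.factorial_succ, doubleFactOdd]
    ring

theorem factorial_two_mul_le (a : ℕ) (ha : 0 < a) :
    (2 * a).factorial ≤ 4 * a * (2 ^ (a - 1) * doubleFactOdd (a - 1)) * a.factorial := by
  obtain ⟨m, rfl⟩ : ∃ m, a = m + 1 := ⟨a - 1, by omega⟩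
  rw [← two_pow_mul_doubleFactOdd_mul_factorial, doubleFactOdd, Nat.add_sub_cancel]
  refine Nat.mul_le_mul_right _ ?_
  calc 2 ^ (m + 1) * ((2 * m + 1) * doubleFactOdd m)
      = (4 * m + 2) * (2 ^ m * doubleFactOdd m) := by ring
    _ ≤ 4 * (m + 1) * (2 ^ m * doubleFactOdd m) := Nat.mul_le_mul_right _ (by omega)

/-- The lower bound `(k/e)^k ≤ k!`. -/
theorem div_exp_one_pow_le_factorial (k : ℕ) :
    ((k : ℝ) / Real.exp 1) ^ k ≤ k.factorial := by
  have h := Real.pow_div_factorial_le_exp (k : ℝ) k.cast_nonneg k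
  rw [div_le_iff₀ (by positivity)] at h
  rw [div_pow, div_le_iff₀ (by positivity), ← Real.exp_nat_mul, mul_one, mul_comm]
  exact h

theorem exists_forall_four_mul_le_pow {q : ℝ} (hq : 1 < q) :
    ∃ A : ℕ, ∀ a : ℕ, A ≤ a → 4 * (a : ℝ) ≤ q ^ a := by
  have h := tendsto_pow_const_div_const_pow_of_one_lt 1 hq
  obtain ⟨A, hA⟩ := Filter.eventually_atTop.1
    (h.eventually (gt_mem_nhds (show (0 : ℝ) < 1 / 4 by norm_num)))
  refine ⟨A, fun a ha => ?_⟩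
  have := hA a ha
  rw [pow_one, div_lt_iff₀ (by positivity)] at this
  linarith

/-- `binom(n,a) c^a ≤ 4 a 2^{a-1} (2a-3)!!` as soon as `c n ≤ (2a/e)^2`. -/
theorem choose_mul_pow_le {n a : ℕ} (ha : 0 < a) {c : ℝ} (hc : 0 ≤ c)
    (h : c * n ≤ ((2 * a : ℕ) / Real.exp 1) ^ 2) :
    (n.choose a : ℝ) * c ^ a ≤ 4 * a * (2 ^ (a - 1) * doubleFactOdd (a - 1)) := by
  have hfac : (0 : ℝ) < a.factorial := by positivity
  refine le_of_mul_le_mul_right ?_ hfac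
  have hchoose : (n.choose a : ℝ) * a.factorial ≤ n ^ a :=
    (le_div_iff₀ hfac).1 (Nat.choose_le_pow_div a n)
  calc (n.choose a : ℝ) * c ^ a * a.factorial
      = (n.choose a : ℝ) * a.factorial * c ^ a := by ring
    _ ≤ n ^ a * c ^ a := by gcongr
    _ = (c * n) ^ a := by rw [mul_pow, mul_comm]
    _ ≤ (((2 * a : ℕ) / Real.exp 1) ^ 2) ^ a := by gcongr
    _ = ((2 * a : ℕ) / Real.exp 1) ^ (2 * a) := by rw [pow_mul]
    _ ≤ (2 * a).factorial := div_exp_one_pow_le_factorial _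
    _ ≤ 4 * a * (2 ^ (a - 1) * doubleFactOdd (a - 1)) * a.factorial := by
      exact_mod_cast factorial_two_mul_le a ha


/-- For every `ε ∈ (0,1/2]` there is `N` such that for all `n ≥ N` and all
`a ≥ (1+ε)·(e/2)·√n`, the expected number `binom(n,a)/(2^{a−1}(2a−3)!!)` of common
leaf-sets of size `a` of two independent copies of the random ordered rooted binary
tree with `n` labelled leaves is at most `(1−ε)^a`. -/
theorem mast_rooted_upper_bound (ε : ℝ) (hε : ε ∈ Set.Ioc (0:ℝ) (1/2)) :
    ∃ N : ℕ, ∀ n : ℕ, N ≤ n → ∀ a : ℕ,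
      (1 + ε) * (Real.exp 1 / 2) * Real.sqrt n ≤ (a : ℝ) →
      (n.choose a : ℝ) / (2^(a-1) * doubleFactOdd (a-1)) ≤ (1 - ε)^a := by
  obtain ⟨hε0, hε1⟩ := hε
  have hq : 1 < (1 + ε) ^ 2 * (1 - ε) := by
    nlinarith [mul_pos hε0 hε0, mul_nonneg hε0.le (sub_nonneg.2 hε1),
      mul_nonneg (mul_pos hε0 hε0).le (sub_nonneg.2 hε1)]
  obtain ⟨A, hA⟩ := exists_forall_four_mul_le_pow hq
  refine ⟨(A + 1) ^ 2, fun n hn a ha => ?_⟩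
  have he : 2 ≤ Real.exp 1 := by linarith [Real.add_one_le_exp (1 : ℝ)]
  have hsqrt : (A : ℝ) + 1 ≤ Real.sqrt n := Real.le_sqrt_of_sq_le (by exact_mod_cast hn)
  have hAa : A + 1 ≤ a := by
    have : (A : ℝ) + 1 ≤ a := calc
      (A : ℝ) + 1 ≤ 1 * Real.sqrt n := by rwa [one_mul]
      _ ≤ (1 + ε) * (Real.exp 1 / 2) * Real.sqrt n := by gcongr; nlinarith
      _ ≤ a := ha
    exact_mod_cast this
  have hn_le : (1 + ε) ^ 2 * n ≤ ((2 * a : ℕ) / Real.exp 1) ^ 2 := by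
    have : (1 + ε) * Real.sqrt n ≤ (2 * a : ℕ) / Real.exp 1 := by
      rw [le_div_iff₀ (Real.exp_pos 1)]
      push_cast
      linarith
    calc (1 + ε) ^ 2 * n = ((1 + ε) * Real.sqrt n) ^ 2 := by
          rw [mul_pow, Real.sq_sqrt n.cast_nonneg]
      _ ≤ _ := by gcongr
  have hD : (0 : ℝ) < 2 ^ (a - 1) * doubleFactOdd (a - 1) :=
    mul_pos (by positivity) (by exact_mod_cast doubleFactOdd_pos (a - 1))
  have hpow : (0 : ℝ) < ((1 + ε) ^ 2) ^ a := by positivity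
  rw [div_le_iff₀ hD]
  refine le_of_mul_le_mul_right ?_ hpow
  calc (n.choose a : ℝ) * ((1 + ε) ^ 2) ^ a
      ≤ 4 * a * (2 ^ (a - 1) * doubleFactOdd (a - 1)) :=
        choose_mul_pow_le (by omega) (by positivity) hn_le
    _ ≤ ((1 + ε) ^ 2 * (1 - ε)) ^ a * (2 ^ (a - 1) * doubleFactOdd (a - 1)) :=
        mul_le_mul_of_nonneg_right (hA a (by omega)) hD.le
    _ = _ := by rw [mul_pow]; ring
end

section
/- For every ε ∈ (0, 1/2] there exists N such that for all integers n ≥ N and all integers a with a ≥ (1 + ε)·(e/√2)·n^{1/2}, one has binom(n, a) / (2a − 3)!! ≤ (1 − ε)^a. (The quantity binom(n,a)/(2a−3)!! is the expected number of common leaf-sets of size a inducing the same rooted subtree in two independent uniformly random unrooted binary trees with leaf-set [n]; hence a maximum agreement rooted subtree of two such trees is likely to have at most (1+o(1))·e·2^{−1/2}·n^{1/2} leaves.) -/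
theorem factorial_mul_two_pow_mul_doubleFactOdd (m : ℕ) :
    m.factorial * 2 ^ m * doubleFactOdd m = (2 * m).factorial := by
  induction m with
  | zero => simp [doubleFactOdd]
  | succ m ih =>
    rw [show 2 * (m + 1) = 2 * m + 1 + 1 by ring, Nat.factorial_succ (2 * m + 1),
      Nat.factorial_succ (2 * m), ← ih, Nat.factorial_succ, doubleFactOdd]
    ring

theorem exists_forall_two_mul_le_pow {R : ℝ} (hR : 1 < R) :
    ∃ A : ℕ, ∀ a : ℕ, A ≤ a → 2 * (a : ℝ) ≤ R ^ a := by
  have h := (tendsto_pow_const_div_const_pow_of_one_lt 1 hR).eventually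
    (ge_mem_nhds (show (0 : ℝ) < 1 / 2 by norm_num))
  obtain ⟨A, hA⟩ := Filter.eventually_atTop.1 h
  refine ⟨A, fun a ha => ?_⟩
  have := hA a ha
  rw [pow_one, div_le_iff₀ (by positivity)] at this
  linarith

/-- The lower bound `(2a)^(2a) ≤ (2a)! e^(2a)`, with `(2a)!` expressed by `(2a-3)!!`. -/
theorem two_mul_sq_pow_le (a : ℕ) (ha : 1 ≤ a) :
    (2 * (a : ℝ) ^ 2) ^ a ≤
      a.factorial * doubleFactOdd (a - 1) * (2 * a) * (Real.exp 1 ^ 2) ^ a := by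
  have hfac : ((2 * a).factorial : ℝ) ≤
      2 ^ a * (a.factorial * doubleFactOdd (a - 1) * (2 * a)) := by
    obtain ⟨m, rfl⟩ : ∃ m, a = m + 1 := ⟨a - 1, by omega⟩
    rw [Nat.add_sub_cancel]
    rw [← factorial_mul_two_pow_mul_doubleFactOdd, doubleFactOdd]
    norm_cast
    calc _ = 2 ^ (m + 1) * ((m + 1).factorial * doubleFactOdd m * (2 * m + 1)) := by ring
      _ ≤ _ := by gcongr; omega
  have h := Real.pow_div_factorial_le_exp (2 * (a : ℝ)) (by positivity) (2 * a)
  rw [div_le_iff₀ (by positivity)] at h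
  have he : Real.exp (2 * (a : ℝ)) = (Real.exp 1 ^ 2) ^ a := by
    rw [← pow_mul, ← Real.exp_nat_mul]; push_cast; ring_nf
  rw [he] at h
  have h2 : (0 : ℝ) < 2 ^ a := by positivity
  refine le_of_mul_le_mul_left ?_ h2
  calc (2 : ℝ) ^ a * (2 * (a : ℝ) ^ 2) ^ a = (2 * (a : ℝ)) ^ (2 * a) := by
        rw [← mul_pow, pow_mul]; ring
    _ ≤ (Real.exp 1 ^ 2) ^ a * (2 * a).factorial := h
    _ ≤ (Real.exp 1 ^ 2) ^ a * (2 ^ a * (a.factorial * doubleFactOdd (a - 1) * (2 * a))) := by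
        gcongr
    _ = _ := by ring

/-- For every `ε ∈ (0,1/2]` there is `N` such that for all `n ≥ N` and all
`a ≥ (1+ε)·(e/√2)·√n`, the expected number `binom(n,a)/(2a−3)!!` of common
leaf-sets of size `a` inducing the same rooted subtree in two independent uniformly
random unrooted binary trees with leaf-set `[n]` is at most `(1−ε)^a`. -/
theorem mast_unrooted_upper_bound (ε : ℝ) (hε : ε ∈ Set.Ioc (0:ℝ) (1/2)) :
    ∃ N : ℕ, ∀ n : ℕ, N ≤ n → ∀ a : ℕ,
      (1 + ε) * (Real.exp 1 / Real.sqrt 2) * Real.sqrt n ≤ (a : ℝ) →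
      (n.choose a : ℝ) / doubleFactOdd (a-1) ≤ (1 - ε)^a := by
  obtain ⟨h0, h1⟩ := hε
  have hR : 1 < (1 - ε) * (1 + ε) ^ 2 := by nlinarith [mul_pos h0 h0]
  obtain ⟨A, hA⟩ := exists_forall_two_mul_le_pow hR
  refine ⟨(A + 1) ^ 2, fun n hn a ha => ?_⟩
  have hsq : (1 + ε) ^ 2 * Real.exp 1 ^ 2 * n ≤ 2 * (a : ℝ) ^ 2 := by
    have h := pow_le_pow_left₀ (by positivity) ha 2
    rw [mul_pow, mul_pow, div_pow, Real.sq_sqrt (by norm_num), Real.sq_sqrt (by positivity)] at h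
    linarith
  have haA : A + 1 ≤ a := by
    have hn' : ((A + 1 : ℕ) : ℝ) ^ 2 ≤ n := by exact_mod_cast hn
    have he : 2 ≤ Real.exp 1 := by linarith [Real.add_one_le_exp (1 : ℝ)]
    have h2 : 2 ≤ (1 + ε) ^ 2 * Real.exp 1 ^ 2 := by
      nlinarith [one_le_pow₀ (n := 2) (show 1 ≤ 1 + ε by linarith)]
    have h3 : ((A + 1 : ℕ) : ℝ) ^ 2 ≤ (a : ℝ) ^ 2 := by
      nlinarith [mul_le_mul_of_nonneg_right h2 (Nat.cast_nonneg (α := ℝ) n)]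
    exact_mod_cast (pow_le_pow_iff_left₀ (by positivity) (by positivity) two_ne_zero).1 h3
  have hD : (0 : ℝ) < doubleFactOdd (a - 1) := by exact_mod_cast doubleFactOdd_pos _
  have hF : (0 : ℝ) < a.factorial := by positivity
  have hpow : (n : ℝ) ^ a ≤ (1 - ε) ^ a * doubleFactOdd (a - 1) * a.factorial := by
    have hc : 0 < ((1 + ε) ^ 2 * Real.exp 1 ^ 2) ^ a := by positivity
    refine le_of_mul_le_mul_left ?_ hc
    calc ((1 + ε) ^ 2 * Real.exp 1 ^ 2) ^ a * (n : ℝ) ^ a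
        = ((1 + ε) ^ 2 * Real.exp 1 ^ 2 * n) ^ a := (mul_pow _ _ _).symm
      _ ≤ (2 * (a : ℝ) ^ 2) ^ a := by gcongr
      _ ≤ a.factorial * doubleFactOdd (a - 1) * (2 * a) * (Real.exp 1 ^ 2) ^ a :=
        two_mul_sq_pow_le a (by omega)
      _ ≤ a.factorial * doubleFactOdd (a - 1) * ((1 - ε) * (1 + ε) ^ 2) ^ a
            * (Real.exp 1 ^ 2) ^ a := by
        gcongr
        exact hA a (by omega)
      _ = _ := by rw [mul_pow, mul_pow]; ring
  rw [div_le_iff₀ hD]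
  exact (Nat.choose_le_pow_div a n).trans ((div_le_iff₀ hF).2 hpow)
end
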